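/- Let G be a connected graph on n vertices with k cut vertices (1 ≤ k ≤ n - 3) that is not a tree. Then for every vertex v of G, the number of connected subgraphs of G containing v is at least ((n-k)^2 + n + k + 2)/2, with equality if and only if G is isomorphic to the lollipop L_{n, n-k} and v is its pendant vertex. -/

import Mathlib

open SimpleGraph

/-- The number of connected subgraphs of `G` (nonempty vertex-and-edge-set pairs
that are connected). -/
noncomputable def numCS {V : Type*} (G : SimpleGraph V) : ℕ :=
  {H : G.Subgraph | H.Connected}.ncard

/-- The number of connected subgraphs of `G` containing the vertex `v`. -/
noncomputable def numCSv {V : Type*} (G : SimpleGraph V) (v : V) : ℕ :=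
  {H : G.Subgraph | H.Connected ∧ v ∈ H.verts}.ncard

/-- The number of connected subgraphs of `G` containing both `v` and `w`. -/
noncomputable def numCSvw {V : Type*} (G : SimpleGraph V) (v w : V) : ℕ :=
  {H : G.Subgraph | H.Connected ∧ v ∈ H.verts ∧ w ∈ H.verts}.ncard

/-- `v` is a cut vertex of `G`: deleting it disconnects the graph. -/
def IsCutVertex {V : Type*} (G : SimpleGraph V) (v : V) : Prop :=
  ¬ (G.induce {u | u ≠ v}).Connected

/-- `G` is 2-connected: connected, at least 3 vertices, and no cut vertex. -/
def TwoConnected {V : Type*} (G : SimpleGraph V) : Prop :=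
  G.Connected ∧ 3 ≤ Nat.card V ∧ ∀ v : V, ¬ IsCutVertex G v

/-- The star `K_{1,n-1}`: vertex `0` is the center, adjacent to all other vertices. -/
def starGraph (n : ℕ) : SimpleGraph (Fin n) :=
  SimpleGraph.fromRel (fun i _ => i.val = 0)

/-- The broom (path-star) `P_{k+1, n-k-1}`: the path `0 - 1 - ⋯ - k` together with the
leaves `k+1, …, n-1` all attached to the vertex `k`. -/
def broom (n k : ℕ) : SimpleGraph (Fin n) :=
  SimpleGraph.fromRel (fun i j => (i.val + 1 = j.val ∧ j.val ≤ k) ∨ (i.val = k ∧ k < j.val))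

/-- The lollipop `L_{n, n-k}`: the cycle `0 - 1 - ⋯ - (n-k-1) - 0` together with the
path `0 - (n-k) - (n-k+1) - ⋯ - (n-1)` attached at the cycle vertex `0`;
its pendant vertex is `n-1`. -/
def lollipop (n k : ℕ) : SimpleGraph (Fin n) :=
  SimpleGraph.fromRel (fun i j =>
    (i.val + 1 = j.val ∧ j.val ≤ n - k - 1) ∨ (i.val = 0 ∧ j.val = n - k - 1) ∨
    (i.val = 0 ∧ j.val = n - k) ∨ (i.val + 1 = j.val ∧ n - k + 1 ≤ j.val))

def avG {V : Type*} (G : SimpleGraph V) (A : Set V) : SimpleGraph V where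
  Adj a b := G.Adj a b ∧ a ∉ A ∧ b ∉ A
  symm := ⟨fun _ _ h => ⟨h.1.symm, h.2.2, h.2.1⟩⟩
  loopless := ⟨fun a h => G.loopless.irrefl a h.1⟩

def sbG {V : Type*} (G : SimpleGraph V) (S : Set V) (F : Set (Sym2 V)) : G.Subgraph where
  verts := S
  Adj a b := G.Adj a b ∧ a ∈ S ∧ b ∈ S ∧ s(a, b) ∉ F
  adj_sub h := h.1
  edge_vert h := h.2.1
  symm := ⟨fun a b h => ⟨h.1.symm, h.2.2.1, h.2.1, by rw [Sym2.eq_swap]; exact h.2.2.2⟩⟩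

theorem reach_closed {V : Type*} {G : SimpleGraph V} {S : Set V} {a b : V}
    (h : G.Reachable a b) (ha : a ∈ S) (hS : ∀ x y, x ∈ S → G.Adj x y → y ∈ S) : b ∈ S := by
  obtain ⟨p⟩ := h
  induction p with
  | nil => exact ha
  | cons hadj _ ih => exact ih (hS _ _ ha hadj)

theorem conn_of {V : Type*} {G : SimpleGraph V} (H : G.Subgraph) (v : V) (hv : v ∈ H.verts)
    (h : ∀ x ∈ H.verts, H.spanningCoe.Reachable v x) : H.Connected := by
  have key : ∀ x, x ∈ H.verts → ∃ hx : x ∈ H.verts, H.coe.Reachable ⟨v, hv⟩ ⟨x, hx⟩ := by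
    intro x hx
    have := reach_closed (S := {x | ∃ hx : x ∈ H.verts, H.coe.Reachable ⟨v, hv⟩ ⟨x, hx⟩}) (h x hx)
      ⟨hv, Reachable.refl _⟩ ?_
    · exact this
    · rintro a b ⟨ha, hr⟩ hab
      have hab' : H.Adj a b := hab
      refine ⟨hab'.snd_mem, hr.trans (Adj.reachable ?_)⟩
      exact hab'
  rw [Subgraph.connected_iff']
  rw [SimpleGraph.connected_iff_exists_forall_reachable]
  exact ⟨⟨v, hv⟩, fun ⟨x, hx⟩ => (key x hx).2⟩

theorem conn_reach {V : Type*} {G : SimpleGraph V} (H : G.Subgraph) (hH : H.Connected) {a b : V}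
    (ha : a ∈ H.verts) (hb : b ∈ H.verts) : H.spanningCoe.Reachable a b := by
  have := (Subgraph.connected_iff'.1 hH).preconnected ⟨a, ha⟩ ⟨b, hb⟩
  exact this.map (⟨Subtype.val, fun h => h⟩ : H.coe →g H.spanningCoe)

theorem sbG_conn {V : Type*} {G : SimpleGraph V} {S : Set V} {F : Set (Sym2 V)} (G' : SimpleGraph V)
    (v : V) (hv : v ∈ S) (h : ∀ x ∈ S, G'.Reachable v x)
    (h' : ∀ a b, G'.Adj a b → G.Adj a b ∧ a ∈ S ∧ b ∈ S ∧ s(a, b) ∉ F) :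
    (sbG G S F).Connected :=
  conn_of _ v hv fun x hx => (h x hx).mono fun a b hab => h' a b hab

theorem nc_reach {V : Type*} {G : SimpleGraph V} {x : V} (h : ¬ IsCutVertex G x) {a b : V}
    (ha : a ≠ x) (hb : b ≠ x) : (avG G {x}).Reachable a b := by
  unfold IsCutVertex at h
  rw [not_not] at h
  have := h.preconnected ⟨a, ha⟩ ⟨b, hb⟩
  exact this.map (⟨Subtype.val, fun {a b} h => ⟨h, a.2, b.2⟩⟩ : G.induce {u | u ≠ x} →g avG G {x})

theorem nc_of {V : Type*} {G : SimpleGraph V} {x v : V} (hv : v ≠ x)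
    (h : ∀ a, a ≠ x → (avG G {x}).Reachable v a) : ¬ IsCutVertex G x := by
  unfold IsCutVertex
  rw [not_not, SimpleGraph.connected_iff_exists_forall_reachable]
  refine ⟨⟨v, hv⟩, fun ⟨y, hy⟩ => ?_⟩
  have := reach_closed (S := {y | ∃ hy : y ≠ x, (G.induce {u | u ≠ x}).Reachable ⟨v, hv⟩ ⟨y, hy⟩})
    (h y hy) ⟨hv, Reachable.refl _⟩ ?_
  · exact this.2
  · rintro a b ⟨ha, hr⟩ hab
    exact ⟨hab.2.2, hr.trans (Adj.reachable hab.1)⟩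

/-- component of `v` after removing `A` -/
def compD {V : Type*} (G : SimpleGraph V) (v : V) (A : Set V) : Set V :=
  {u | (avG G A).Reachable v u}

def bdD {V : Type*} (G : SimpleGraph V) (D : Set V) : Set V :=
  {x | x ∉ D ∧ ∃ d ∈ D, G.Adj d x}

theorem compD_disj {V : Type*} {G : SimpleGraph V} {v : V} {A : Set V} (hv : v ∉ A) {x : V}
    (hx : x ∈ compD G v A) : x ∉ A :=
  reach_closed (S := Aᶜ) hx hv fun _ _ _ h => h.2.2

theorem bd_sub {V : Type*} {G : SimpleGraph V} {v : V} {A : Set V} (hv : v ∉ A) :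
    bdD G (compD G v A) ⊆ A := by
  rintro x ⟨hx, d, hd, hdx⟩
  by_contra hxA
  exact hx (Reachable.trans hd (Adj.reachable ⟨hdx, compD_disj hv hd, hxA⟩))

theorem bd_single {V : Type*} {G : SimpleGraph V} (hG : G.Connected) {v x : V} (hv : v ≠ x) :
    bdD G (compD G v {x}) = {x} := by
  apply Set.Subset.antisymm (bd_sub (by simpa using hv))
  rw [Set.singleton_subset_iff]
  have hx : x ∉ compD G v {x} := fun h => compD_disj (by simpa using hv) h rfl
  by_contra hb
  refine hx (reach_closed (hG.preconnected v x) (Reachable.refl _) fun a b ha hab => ?_)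
  by_contra hb'
  have : b ∈ bdD G (compD G v {x}) := ⟨hb', a, ha, hab⟩
  have h2 := bd_sub (by simpa using hv) this
  rw [Set.mem_singleton_iff] at h2
  exact hb (h2 ▸ this)

theorem bd_pair_aux {V : Type*} {G : SimpleGraph V} {v x y : V} (hx : v ≠ x) (hy : v ≠ y)
    (hxy : x ≠ y) (cy : ¬ IsCutVertex G y) :
    x ∈ bdD G (compD G v {x, y}) := by
  have hv : v ∉ ({x, y} : Set V) := by simp [hx, hy]
  have hx' : x ∉ compD G v {x, y} := fun h => compD_disj hv h (by simp)
  by_contra hb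
  refine hx' (reach_closed (nc_reach cy hy hxy) (Reachable.refl _) fun a b ha hab => ?_)
  by_contra hb'
  have : b ∈ bdD G (compD G v {x, y}) := ⟨hb', a, ha, hab.1⟩
  have h2 := bd_sub hv this
  have h3 := hab.2.2
  simp only [Set.mem_insert_iff, Set.mem_singleton_iff] at h2 h3
  rcases h2 with h2 | h2
  · exact hb (h2 ▸ this)
  · exact h3 h2

theorem bd_pair {V : Type*} {G : SimpleGraph V} {v x y : V} (hx : v ≠ x) (hy : v ≠ y)
    (hxy : x ≠ y) (cx : ¬ IsCutVertex G x) (cy : ¬ IsCutVertex G y) :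
    bdD G (compD G v {x, y}) = {x, y} := by
  apply Set.Subset.antisymm (bd_sub (by simp [hx, hy]))
  rintro z (rfl | rfl)
  · exact bd_pair_aux hx hy hxy cy
  · rw [Set.pair_comm]; exact bd_pair_aux hy hx hxy.symm cx

theorem sbG_induced {V : Type*} {G : SimpleGraph V} (S : Set V) : (sbG G S ∅).IsInduced := by
  intro a ha b hb hab
  exact ⟨hab, ha, hb, by simp⟩

open Classical in
theorem count_induced {V : Type*} [Fintype V] (G : SimpleGraph V) (hG : G.Connected) (v : V)
    (N : Finset V) (hN : ∀ x ∈ N, x ≠ v ∧ ¬ IsCutVertex G x) :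
    Fintype.card V + N.card.choose 2 ≤
      {H : G.Subgraph | (H.Connected ∧ v ∈ H.verts) ∧ H.IsInduced}.ncard := by
  let U : Finset V := Finset.univ.erase v
  let 𝒜 : Finset (Finset V) :=
    (Finset.powersetCard 0 U ∪ Finset.powersetCard 1 U) ∪ Finset.powersetCard 2 N
  have hU : U.card + 1 = Fintype.card V := by
    rw [Finset.card_erase_add_one (Finset.mem_univ v)]; rfl
  have hcard : 𝒜.card = Fintype.card V + N.card.choose 2 := by
    rw [Finset.card_union_of_disjoint, Finset.card_union_of_disjoint]
    · simp only [Finset.card_powersetCard]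
      simp
      omega
    · rw [Finset.disjoint_left]
      intro s hs hs'
      rw [Finset.mem_powersetCard] at hs hs'
      omega
    · rw [Finset.disjoint_left]
      intro s hs hs'
      rw [Finset.mem_union, Finset.mem_powersetCard, Finset.mem_powersetCard] at hs
      rw [Finset.mem_powersetCard] at hs'
      omega
  have hb : ∀ A ∈ 𝒜, v ∉ A ∧ bdD G (compD G v (A : Set V)) = A := by
    intro A hA
    have hA' := hA
    simp only [𝒜, Finset.mem_union, Finset.mem_powersetCard] at hA
    rcases hA with (⟨h1, h2⟩ | ⟨h1, h2⟩) | ⟨h1, h2⟩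
    · rw [Finset.card_eq_zero] at h2
      subst h2
      refine ⟨by simp, ?_⟩
      have := bd_sub (G := G) (v := v) (A := ((∅ : Finset V) : Set V)) (by simp)
      simpa using this
    · obtain ⟨x, rfl⟩ := Finset.card_eq_one.1 h2
      have hx : v ≠ x := by
        have := h1 (Finset.mem_singleton_self x)
        exact (Finset.mem_erase.1 this).1.symm
      refine ⟨by simpa using hx, ?_⟩
      simpa using bd_single hG hx
    · obtain ⟨x, y, hxy, rfl⟩ := Finset.card_eq_two.1 h2
      have hx := hN x (h1 (by simp))
      have hy := hN y (h1 (by simp))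
      refine ⟨by simp [hx.1.symm, hy.1.symm], ?_⟩
      simpa using bd_pair hx.1.symm hy.1.symm hxy hx.2 hy.2
  rw [← hcard, ← Set.ncard_coe_finset]
  refine Set.ncard_le_ncard_of_injOn (fun A => sbG G (compD G v (A : Set V)) ∅) ?_ ?_ (Set.toFinite _)
  · intro A hA
    refine ⟨⟨?_, Reachable.refl _⟩, sbG_induced _⟩
    have hv := (hb A hA).1
    have hv' : v ∉ (A : Set V) := by simpa using hv
    let D := compD G v (A : Set V)
    refine conn_of _ v (Reachable.refl _) ?_
    intro x hx
    have := reach_closed (S := {x | x ∈ D ∧ (sbG G D ∅).spanningCoe.Reachable v x}) hx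
      ⟨Reachable.refl _, Reachable.refl _⟩ ?_
    · exact this.2
    · rintro a b ⟨ha, hr⟩ hab
      have hbD : b ∈ D := Reachable.trans ha (Adj.reachable hab)
      exact ⟨hbD, hr.trans (Adj.reachable ⟨hab.1, ha, hbD, by simp⟩)⟩
  · intro A hA B hB hAB
    have h1 : compD G v (A : Set V) = compD G v (B : Set V) := congrArg Subgraph.verts hAB
    have h2 := (hb A hA).2
    rw [h1, (hb B hB).2] at h2
    exact_mod_cast h2.symm

/-- the graph of non-bridge edges -/
def nbG {V : Type*} (G : SimpleGraph V) : SimpleGraph V where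
  Adj a b := G.Adj a b ∧ ¬ G.IsBridge s(a, b)
  symm := ⟨fun a b h => ⟨h.1.symm, by rw [Sym2.eq_swap]; exact h.2⟩⟩
  loopless := ⟨fun a h => G.loopless.irrefl a h.1⟩

theorem nb_of_nc {V : Type*} {G : SimpleGraph V} {x y z : V} (hx : ¬ IsCutVertex G x)
    (hxy : G.Adj x y) (hxz : G.Adj x z) (hyz : z ≠ y) : (nbG G).Adj x y := by
  refine ⟨hxy, ?_⟩
  rw [isBridge_iff, not_not]
  have h1 : (G.deleteEdges {s(x, y)}).Adj x z := by
    rw [deleteEdges_adj]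
    refine ⟨hxz, ?_⟩
    simp only [Set.mem_singleton_iff, Sym2.eq_iff]
    grind
  refine h1.reachable.trans ((nc_reach hx hxz.ne' hxy.ne').mono ?_)
  intro a b hab
  rw [deleteEdges_adj]
  refine ⟨hab.1, ?_⟩
  have h2 := hab.2.1
  have h3 := hab.2.2
  simp only [Set.mem_singleton_iff, Sym2.eq_iff] at *
  grind

theorem exists_nb {V : Type*} {G : SimpleGraph V} (hG : G.Connected) (hnt : ¬ G.IsTree) :
    ∃ a b, (nbG G).Adj a b := by
  by_contra hcon
  push Not at hcon
  apply hnt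
  refine ⟨hG, ?_⟩
  rw [isAcyclic_iff_forall_adj_isBridge]
  intro a b hab
  by_contra hb
  exact hcon a b ⟨hab, hb⟩

theorem exists_cut_nb {V : Type*} {G : SimpleGraph V} (hG : G.Connected) (hnt : ¬ G.IsTree)
    (u : V) (hu : IsCutVertex G u) : ∃ c y, IsCutVertex G c ∧ (nbG G).Adj c y := by
  by_contra hcon
  push Not at hcon
  obtain ⟨a, b, hab⟩ := exists_nb hG hnt
  have := reach_closed (S := {x | ∃ y, (nbG G).Adj x y}) (hG.preconnected a u) ⟨b, hab⟩ ?_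
  · obtain ⟨y, hy⟩ := this
    exact hcon u y hu hy
  · rintro x z ⟨y, hxy⟩ hxz
    by_cases hzy : z = y
    · subst hzy; exact ⟨x, hxy.symm⟩
    · have hx : ¬ IsCutVertex G x := fun h => hcon x y h hxy
      exact ⟨x, (nb_of_nc hx hxz hxy.1 (Ne.symm hzy)).symm⟩

open Classical in
theorem nb_card {V : Type*} [Fintype V] {G : SimpleGraph V} (hG : G.Connected) (hnt : ¬ G.IsTree)
    (u : V) (hu : IsCutVertex G u) (Q : Finset V)
    (hQ : ∀ x ∈ Q, ¬ IsCutVertex G x ∧ 2 ≤ G.degree x) :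
    Q.card + 1 ≤ (nbG G).edgeFinset.card := by
  obtain ⟨c, y, hc, hcy⟩ := exists_cut_nb hG hnt u hu
  have h1 := (nbG G).sum_degrees_eq_twice_card_edges
  have h2 : ∑ x, ((if x ∈ Q then 2 else 0) + (if x = c then 1 else 0)) ≤ ∑ x, (nbG G).degree x := by
    apply Finset.sum_le_sum
    intro x _
    by_cases hx : x ∈ Q
    · have hxc : x ≠ c := by
        rintro rfl; exact (hQ x hx).1 hc
      simp only [hx, hxc, if_true, if_false]
      have h3 : 1 < (G.neighborFinset x).card := (hQ x hx).2
      obtain ⟨a, ha, b, hb, hab⟩ := Finset.one_lt_card.1 h3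
      rw [mem_neighborFinset] at ha hb
      have : 1 < ((nbG G).neighborFinset x).card := by
        rw [Finset.one_lt_card]
        refine ⟨a, ?_, b, ?_, hab⟩
        · rw [mem_neighborFinset]; exact nb_of_nc (hQ x hx).1 ha hb hab.symm
        · rw [mem_neighborFinset]; exact nb_of_nc (hQ x hx).1 hb ha hab
      exact this
    · by_cases hxc : x = c
      · subst hxc
        simp only [hx, if_true, if_false]
        have : 0 < (nbG G).degree x := (degree_pos_iff_exists_adj _ _).2 ⟨y, hcy⟩
        omega
      · simp [hx, hxc]
  rw [Finset.sum_add_distrib, h1] at h2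
  simp at h2
  omega

theorem leaf_reach {V : Type*} {G : SimpleGraph V} (hG : G.Connected) {v x y : V} (hv : v ≠ x)
    (hx : ∀ z, G.Adj x z → z = y) (u : V) (hu : u ≠ x) : (avG G {x}).Reachable v u := by
  have := reach_closed (S := {u | (u ≠ x → (avG G {x}).Reachable v u) ∧
    (u = x → (avG G {x}).Reachable v y)}) (hG.preconnected v u)
    ⟨fun _ => Reachable.refl _, fun h => absurd h hv⟩ ?_
  · exact this.1 hu
  · rintro a b ⟨h1, h2⟩ hab
    constructor
    · intro hb
      by_cases ha : a = x
      · subst ha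
        rw [hx b hab]; exact h2 rfl
      · exact (h1 ha).trans (Adj.reachable ⟨hab, ha, hb⟩)
    · rintro rfl
      have : a = y := hx a hab.symm
      rw [← this]; exact h1 hab.ne

theorem leaf_nb {V : Type*} {G : SimpleGraph V} {x y : V}
    (hx : ∀ z, G.Adj x z → z = y) (b : V) (hb : (nbG G).Adj x b) : False := by
  have h1 := hb.2
  rw [isBridge_iff, not_not] at h1
  have h2 := hx b hb.1
  have := reach_closed (S := {x}) h1 rfl ?_
  · exact hb.1.ne this.symm
  · rintro a z rfl haz
    rw [deleteEdges_adj] at haz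
    have := hx z haz.1
    exact absurd (by simp [this, h2]) haz.2

theorem nb_del_conn {V : Type*} {G : SimpleGraph V} (hG : G.Connected) {e : Sym2 V}
    (he : e ∈ (nbG G).edgeSet) : (G.deleteEdges {e}).Connected := by
  induction e with
  | h a b => exact hG.connected_delete_edge_of_not_isBridge he.2

open Classical in
theorem count_nonind {V : Type*} [Fintype V] (G : SimpleGraph V) (hG : G.Connected)
    (hnt : ¬ G.IsTree) (v : V)
    (L : Finset V) (hL : ∀ x ∈ L, x ≠ v ∧ ∃ y, ∀ z, G.Adj x z → z = y) :
    (L.card + 1) * (nbG G).edgeFinset.card +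
      (if Fintype.card V < G.edgeFinset.card then 1 else 0) ≤
      {H : G.Subgraph | (H.Connected ∧ v ∈ H.verts) ∧ ¬ H.IsInduced}.ncard := by
  let T : Set G.Subgraph := {H : G.Subgraph | (H.Connected ∧ v ∈ H.verts) ∧ ¬ H.IsInduced}
  let f : Option V × Sym2 V → G.Subgraph := fun p => sbG G {x | some x ≠ p.1} {p.2}
  let P : Finset (Option V × Sym2 V) := L.insertNone ×ˢ (nbG G).edgeFinset
  have hP : P.card = (L.card + 1) * (nbG G).edgeFinset.card := by
    simp [P, Finset.card_product]
  have hmem : ∀ o ∈ L.insertNone, ∀ a b, (nbG G).Adj a b → some a ≠ o ∧ some b ≠ o := by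
    intro o ho a b hab
    constructor
    · rintro rfl
      obtain ⟨-, y, hy⟩ := hL a (by simpa using ho)
      exact leaf_nb hy b hab
    · rintro rfl
      obtain ⟨-, y, hy⟩ := hL b (by simpa using ho)
      exact leaf_nb hy a hab.symm
  have hinj : Set.InjOn f (P : Set (Option V × Sym2 V)) := by
    rintro ⟨o, e⟩ h1 ⟨o', e'⟩ h2 heq
    simp only [P, Finset.coe_product, Set.mem_prod, Finset.mem_coe, mem_edgeFinset] at h1 h2
    have hv1 : {x | some x ≠ o} = {x | some x ≠ o'} := congrArg Subgraph.verts heq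
    have ho : o = o' := by
      rw [Set.ext_iff] at hv1
      simp only [Set.mem_ofPred_eq] at hv1
      cases o with
      | none =>
        cases o' with
        | none => rfl
        | some x => have := hv1 x; simp at this
      | some x =>
        have := hv1 x
        by_contra hne
        simp [hne] at this
    subst ho
    congr 1
    induction e with
    | h a b =>
      by_contra hne
      obtain ⟨h3, h4⟩ := hmem o h1.1 a b h1.2
      have : (f (o, e')).Adj a b := ⟨h1.2.1, h3, h4, hne⟩
      rw [← heq] at this
      exact this.2.2.2 rfl
  have hsub : f '' (P : Set (Option V × Sym2 V)) ⊆ T := by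
    rintro _ ⟨⟨o, e⟩, h1, rfl⟩
    simp only [P, Finset.coe_product, Set.mem_prod, Finset.mem_coe, mem_edgeFinset] at h1
    have hc := nb_del_conn hG h1.2
    have hvo : some v ≠ o := by
      rintro rfl
      exact (hL v (by simpa using h1.1)).1 rfl
    refine ⟨⟨?_, hvo⟩, ?_⟩
    · cases o with
      | none =>
        refine sbG_conn (G.deleteEdges {e}) v hvo (fun x _ => hc.preconnected v x) ?_
        intro a b hab
        rw [deleteEdges_adj] at hab
        exact ⟨hab.1, by simp, by simp, hab.2⟩
      | some x =>
        obtain ⟨hxv, y, hy⟩ := hL x (by simpa using h1.1)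
        refine sbG_conn (avG (G.deleteEdges {e}) {x}) v hvo
          (fun u hu => leaf_reach hc hxv.symm (y := y) ?_ u ?_) ?_
        · intro z hz
          rw [deleteEdges_adj] at hz
          exact hy z hz.1
        · simpa using hu
        · intro a b hab
          have h2 := hab.1
          rw [deleteEdges_adj] at h2
          exact ⟨h2.1, by simpa using hab.2.1, by simpa using hab.2.2, h2.2⟩
    · intro hind
      induction e with
      | h a b =>
        obtain ⟨h3, h4⟩ := hmem o h1.1 a b h1.2
        have := hind h3 h4 h1.2.1
        exact this.2.2.2 rfl
  have hcard : (f '' (P : Set (Option V × Sym2 V))).ncard = P.card := by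
    rw [Set.InjOn.ncard_image hinj, Set.ncard_coe_finset]
  rw [← hP, ← hcard]
  split_ifs with hE
  · apply Set.ncard_lt_ncard _ (Set.toFinite _)
    refine ⟨hsub, fun hcon => ?_⟩
    obtain ⟨a, b, hab⟩ := exists_nb hG hnt
    have hc1 : (G.deleteEdges {s(a, b)}).Connected := nb_del_conn hG (e := s(a, b)) hab
    have hnt1 : ¬ (G.deleteEdges {s(a, b)}).IsTree := by
      intro ht
      have h1 := ht.card_edgeFinset
      have h2 : (G.deleteEdges {s(a, b)}).edgeFinset = G.edgeFinset.erase s(a, b) := by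
        ext e
        simp [mem_edgeFinset, edgeSet_deleteEdges, and_comm]
      have h3 : s(a, b) ∈ G.edgeFinset := by rw [mem_edgeFinset]; exact hab.1
      have h4 := Finset.card_erase_add_one h3
      rw [← h2] at h4
      omega
    obtain ⟨c, d, hcd⟩ := exists_nb hc1 hnt1
    have hc2 : ((G.deleteEdges {s(a, b)}).deleteEdges {s(c, d)}).Connected :=
      nb_del_conn hc1 (e := s(c, d)) hcd
    have hcd1 := hcd.1
    rw [deleteEdges_adj] at hcd1
    have ht : sbG G Set.univ {s(a, b), s(c, d)} ∈ T := by
      refine ⟨⟨?_, Set.mem_univ v⟩, fun hind => ?_⟩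
      · refine sbG_conn _ v (Set.mem_univ v) (fun x _ => hc2.preconnected v x) ?_
        intro x y hxy
        rw [deleteEdges_adj, deleteEdges_adj] at hxy
        refine ⟨hxy.1.1, by simp, by simp, ?_⟩
        rintro (h | h)
        · exact hxy.1.2 h
        · exact hxy.2 h
      · have := hind (Set.mem_univ a) (Set.mem_univ b) hab.1
        exact this.2.2.2 (by simp)
    obtain ⟨⟨o, e⟩, h1, h2⟩ := hcon ht
    simp only [P, Finset.coe_product, Set.mem_prod, Finset.mem_coe, mem_edgeFinset] at h1
    have hv1 : {x | some x ≠ o} = Set.univ := congrArg Subgraph.verts h2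
    have ho : ∀ x, some x ≠ o := fun x => by
      have : x ∈ {x | some x ≠ o} := by rw [hv1]; trivial
      exact this
    have key : ∀ x y, G.Adj x y → s(x, y) ∈ ({s(a, b), s(c, d)} : Set (Sym2 V)) → s(x, y) = e := by
      intro x y hxy hm
      by_contra hne
      have : (f (o, e)).Adj x y := ⟨hxy, ho x, ho y, hne⟩
      rw [h2] at this
      exact this.2.2.2 hm
    have k1 := key a b hab.1 (by simp)
    have k2 := key c d hcd1.1 (by simp)
    exact hcd1.2 (by simp [k1, k2])
  · exact Set.ncard_le_ncard hsub (Set.toFinite _)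

def lolA (n k i i' : ℕ) : Prop := i' = i + 1 ∨ (i = k ∧ i' = n - 1)

structure IsLol {V : Type*} (G : SimpleGraph V) (v : V) (n k : ℕ) (p : ℕ → V) : Prop where
  zero : p 0 = v
  inj : ∀ i i', i < n → i' < n → p i = p i' → i = i'
  surj : ∀ x, ∃ i, i < n ∧ p i = x
  adj : ∀ i i', i < n → i' < n → (G.Adj (p i) (p i') ↔ lolA n k i i' ∨ lolA n k i' i)

def lolR (n k i j : ℕ) : Prop :=
  (i + 1 = j ∧ j ≤ n - k - 1) ∨ (i = 0 ∧ j = n - k - 1) ∨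
    (i = 0 ∧ j = n - k) ∨ (i + 1 = j ∧ n - k + 1 ≤ j)

theorem lol_arith1 (n k : ℕ) (hk : 1 ≤ k) (hkn : k + 3 ≤ n) (i i' a b : ℕ)
    (ha : a < n) (hb : b < n)
    (hi : i = if a < k then n - 1 - a else a - k)
    (hi' : i' = if b < k then n - 1 - b else b - k) (h : lolA n k a b) :
    i ≠ i' ∧ (lolR n k i i' ∨ lolR n k i' i) := by
  unfold lolR
  rcases h with h | ⟨h, h'⟩
  · by_cases h1 : b < k
    · rw [if_pos (by omega)] at hi hi'
      refine ⟨by omega, Or.inr (Or.inr (Or.inr (Or.inr ⟨by omega, by omega⟩)))⟩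
    · rw [if_neg h1] at hi'
      by_cases h2 : a < k
      · rw [if_pos h2] at hi
        refine ⟨by omega, Or.inr (Or.inr (Or.inr (Or.inl ⟨by omega, by omega⟩)))⟩
      · rw [if_neg h2] at hi
        refine ⟨by omega, Or.inl (Or.inl ⟨by omega, by omega⟩)⟩
  · rw [if_neg (by omega)] at hi hi'
    refine ⟨by omega, Or.inl (Or.inr (Or.inl ⟨by omega, by omega⟩))⟩

theorem lol_arith2 (n k : ℕ) (hk : 1 ≤ k) (hkn : k + 3 ≤ n) (i i' a b : ℕ)
    (ha : a < n) (hb : b < n)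
    (hi : i = if a < k then n - 1 - a else a - k)
    (hi' : i' = if b < k then n - 1 - b else b - k) (h : lolR n k i i') :
    lolA n k a b ∨ lolA n k b a := by
  unfold lolA
  rcases h with h | h | h | h
  · have c1 : ¬ a < k := by split_ifs at hi <;> omega
    rw [if_neg c1] at hi
    have c2 : ¬ b < k := by split_ifs at hi' <;> omega
    rw [if_neg c2] at hi'
    left; left; omega
  · have c1 : ¬ a < k := by split_ifs at hi <;> omega
    rw [if_neg c1] at hi
    have c2 : ¬ b < k := by split_ifs at hi' <;> omega
    rw [if_neg c2] at hi'
    left; right; omega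
  · have c1 : ¬ a < k := by split_ifs at hi <;> omega
    rw [if_neg c1] at hi
    have c2 : b < k := by split_ifs at hi' <;> omega
    rw [if_pos c2] at hi'
    right; left; omega
  · have c1 : a < k := by split_ifs at hi <;> omega
    rw [if_pos c1] at hi
    have c2 : b < k := by split_ifs at hi' <;> omega
    rw [if_pos c2] at hi'
    right; left; omega

theorem lol_arith (n k : ℕ) (hk : 1 ≤ k) (hkn : k + 3 ≤ n) (i i' : Fin n) (a b : ℕ)
    (ha : a < n) (hb : b < n)
    (hi : i.val = if a < k then n - 1 - a else a - k)
    (hi' : i'.val = if b < k then n - 1 - b else b - k) :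
    (lollipop n k).Adj i i' ↔ lolA n k a b ∨ lolA n k b a := by
  unfold lollipop
  rw [fromRel_adj, Ne, Fin.ext_iff]
  change (_ ∧ (lolR n k i i' ∨ lolR n k i' i)) ↔ _
  constructor
  · rintro ⟨-, h | h⟩
    · exact lol_arith2 n k hk hkn _ _ a b ha hb hi hi' h
    · exact (lol_arith2 n k hk hkn _ _ b a hb ha hi' hi h).symm
  · rintro (h | h)
    · exact lol_arith1 n k hk hkn _ _ a b ha hb hi hi' h
    · have := lol_arith1 n k hk hkn _ _ b a hb ha hi' hi h
      exact ⟨fun h => this.1 h.symm, this.2.symm⟩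

theorem isLol_of_iso {V : Type*} (G : SimpleGraph V) (v : V) (n k : ℕ) (hk : 1 ≤ k)
    (hkn : k + 3 ≤ n) (φ : G ≃g lollipop n k) (hφ : φ v = ⟨n - 1, by omega⟩) :
    ∃ p, IsLol G v n k p := by
  let q : ℕ → Fin n := fun i =>
    ⟨min (if i < k then n - 1 - i else i - k) (n - 1), by omega⟩
  have hq : ∀ i, i < n → (q i).val = if i < k then n - 1 - i else i - k := by
    intro i hi
    simp only [q]
    split_ifs <;> omega
  refine ⟨fun i => φ.symm (q i), ?_, ?_, ?_, ?_⟩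
  · have : q 0 = φ v := by
      rw [hφ]; ext; rw [hq 0 (by omega)]; simp; omega
    show φ.symm (q 0) = v
    rw [this]; simp
  · intro i i' hi hi' h
    have h1 := φ.symm.injective h
    have h2 := congrArg Fin.val h1
    rw [hq i hi, hq i' hi'] at h2
    split_ifs at h2 <;> omega
  · intro x
    have hx := (φ x).isLt
    refine ⟨if (φ x).val < n - k then (φ x).val + k else n - 1 - (φ x).val, ?_, ?_⟩
    · split_ifs <;> omega
    · have : q (if (φ x).val < n - k then (φ x).val + k else n - 1 - (φ x).val) = φ x := by
        ext
        rw [hq _ (by split_ifs <;> omega)]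
        split_ifs <;> omega
      show φ.symm (q _) = x
      rw [this]; simp
  · intro i i' hi hi'
    have h1 : G.Adj (φ.symm (q i)) (φ.symm (q i')) ↔ (lollipop n k).Adj (q i) (q i') :=
      φ.symm.map_adj_iff
    show G.Adj (φ.symm (q i)) (φ.symm (q i')) ↔ _
    rw [h1]
    exact lol_arith n k hk hkn _ _ i i' hi hi' (hq i hi) (hq i' hi')

theorem iso_of_isLol {V : Type*} (G : SimpleGraph V) (v : V) (n k : ℕ) (hk : 1 ≤ k)
    (hkn : k + 3 ≤ n) (p : ℕ → V) (hp : IsLol G v n k p) :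
    ∃ φ : G ≃g lollipop n k, φ v = ⟨n - 1, by omega⟩ := by
  let q : Fin n → ℕ := fun i => if i.val < n - k then k + i.val else n - 1 - i.val
  have hqn : ∀ i, q i < n := by
    intro i
    have := i.isLt
    simp only [q]
    split_ifs <;> omega
  have hqv : ∀ i, i.val = if q i < k then n - 1 - q i else q i - k := by
    intro i
    have := i.isLt
    simp only [q]
    split_ifs <;> omega
  have hbij : Function.Bijective (fun i => p (q i)) := by
    constructor
    · intro i i' h
      have h1 := hp.inj _ _ (hqn i) (hqn i') h
      have := i.isLt
      have := i'.isLt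
      simp only [q] at h1
      ext
      split_ifs at h1 <;> omega
    · intro x
      obtain ⟨i, hi, rfl⟩ := hp.surj x
      refine ⟨⟨if i < k then n - 1 - i else i - k, by split_ifs <;> omega⟩, ?_⟩
      show p (q _) = p i
      congr 1
      simp only [q]
      split_ifs <;> omega
  let ψ : lollipop n k ≃g G := ⟨Equiv.ofBijective _ hbij, by
    intro i i'
    show G.Adj (p (q i)) (p (q i')) ↔ _
    rw [hp.adj _ _ (hqn i) (hqn i')]
    exact (lol_arith n k hk hkn i i' _ _ (hqn i) (hqn i') (hqv i) (hqv i')).symm⟩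
  refine ⟨ψ.symm, ?_⟩
  have : ψ ⟨n - 1, by omega⟩ = v := by
    show p (q _) = v
    rw [← hp.zero]
    congr 1
    simp only [q]
    split_ifs <;> omega
  rw [← this]
  simp

theorem isLol_cut {V : Type*} [Fintype V] (G : SimpleGraph V) (hG : G.Connected) (v : V) (n k : ℕ)
    (hk : 1 ≤ k) (hkn : k + 3 ≤ n) (p : ℕ → V) (hp : IsLol G v n k p) :
    {v : V | IsCutVertex G v}.ncard ≤ k := by
  classical
  have hsub : {v : V | IsCutVertex G v} ⊆ ((Finset.Icc 1 k).image p : Finset V) := by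
    intro x hx
    obtain ⟨i, hi, rfl⟩ := hp.surj x
    by_contra hne
    have hi2 : ¬ (1 ≤ i ∧ i ≤ k) := by
      intro h
      apply hne
      simp only [Finset.coe_image, Finset.coe_Icc]
      exact ⟨i, h, rfl⟩
    have hpn : ∀ a, a < n → a ≠ i → p a ≠ p i := fun a ha hai h => hai (hp.inj _ _ ha hi h)
    refine absurd hx ?_
    show ¬ IsCutVertex G (p i)
    by_cases hi0 : i = 0
    · subst hi0
      refine nc_of (v := p 1) (hpn 1 (by omega) (by omega)) fun a ha =>
        leaf_reach hG (hpn 1 (by omega) (by omega)) (y := p 1) ?_ a ha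
      intro z hz
      obtain ⟨i, hi, rfl⟩ := hp.surj z
      rw [hp.adj _ _ (by omega) hi] at hz
      unfold lolA at hz
      congr 1
      omega
    · have hstep : ∀ a b, a < n → b < n → a ≠ i → b ≠ i → (lolA n k a b ∨ lolA n k b a) →
          (avG G {p i}).Adj (p a) (p b) := by
        intro a b ha hb hai hbi hab
        exact ⟨(hp.adj _ _ ha hb).2 hab, hpn a ha hai, hpn b hb hbi⟩
      have hlow : ∀ a, a < i → (avG G {p i}).Reachable (p 0) (p a) := by
        intro a
        induction a with
        | zero => intro _; exact Reachable.refl _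
        | succ a ih =>
          intro ha
          exact (ih (by omega)).trans (hstep a (a + 1) (by omega) (by omega) (by omega) (by omega)
            (Or.inl (Or.inl rfl))).reachable
      have hhigh : ∀ t, i < n - 1 - t → (avG G {p i}).Reachable (p 0) (p (n - 1 - t)) := by
        intro t
        induction t with
        | zero =>
          intro h
          exact (hlow k (by omega)).trans (hstep k (n - 1 - 0) (by omega) (by omega) (by omega)
            (by omega) (Or.inl (Or.inr ⟨rfl, rfl⟩))).reachable
        | succ t ih =>
          intro h
          exact (ih (by omega)).trans (hstep (n - 1 - t) (n - 1 - (t + 1)) (by omega) (by omega)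
            (by omega) (by omega) (Or.inr (Or.inl (by omega)))).reachable
      refine nc_of (v := p 0) (hpn 0 (by omega) (by omega)) fun x hx => ?_
      obtain ⟨a, ha, rfl⟩ := hp.surj x
      rcases lt_trichotomy a i with h | h | h
      · exact hlow a h
      · subst h; exact absurd rfl hx
      · have := hhigh (n - 1 - a) (by omega)
        rwa [show n - 1 - (n - 1 - a) = a by omega] at this
  calc _ ≤ _ := Set.ncard_le_ncard hsub (Set.toFinite _)
    _ = ((Finset.Icc 1 k).image p).card := Set.ncard_coe_finset _
    _ ≤ (Finset.Icc 1 k).card := Finset.card_image_le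
    _ = k := by simp

def nxt (n k i : ℕ) : ℕ := if i = n - 1 then k else i + 1

theorem sum_tri (m : ℕ) : ∑ t ∈ Finset.range m, (m - t) = (m + 1).choose 2 := by
  induction m with
  | zero => simp
  | succ m ih =>
    rw [Finset.sum_range_succ']
    simp only [Nat.add_sub_add_right, ih]
    rw [Nat.choose_succ_succ' (m + 1) 1]
    simp
    omega

def lolK {V : Type*} (G : SimpleGraph V) (n k : ℕ) (p : ℕ → V) (a b : ℕ) : G.Subgraph :=
  sbG G {x | ∃ i, i < n ∧ p i = x ∧ (i ≤ a ∨ b < i)}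
    {e | ∃ i, a ≤ i ∧ i ≤ b ∧ e = s(p i, p (nxt n k i))}

theorem isLol_upper {V : Type*} [Fintype V] (G : SimpleGraph V) (v : V) (n k : ℕ)
    (hk : 1 ≤ k) (hkn : k + 3 ≤ n) (p : ℕ → V) (hp : IsLol G v n k p) :
    numCSv G v ≤ 1 + n + (n - k).choose 2 := by
  classical
  have hnx : ∀ i, i < n → nxt n k i < n := by
    intro i hi; unfold nxt; split_ifs <;> omega
  have hadj : ∀ x y, G.Adj x y → ∃ i, i < n ∧
      ((x = p i ∧ y = p (nxt n k i)) ∨ (y = p i ∧ x = p (nxt n k i))) := by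
    intro x y hxy
    obtain ⟨i, hi, rfl⟩ := hp.surj x
    obtain ⟨i', hi', rfl⟩ := hp.surj y
    rw [hp.adj _ _ hi hi'] at hxy
    unfold lolA at hxy
    rcases hxy with (h | h) | (h | h)
    · refine ⟨i, hi, Or.inl ⟨rfl, ?_⟩⟩
      unfold nxt; rw [if_neg (by omega), h]
    · refine ⟨i', hi', Or.inr ⟨rfl, ?_⟩⟩
      unfold nxt; rw [if_pos (by omega), h.1]
    · refine ⟨i', hi', Or.inr ⟨rfl, ?_⟩⟩
      unfold nxt; rw [if_neg (by omega), h]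
    · refine ⟨i, hi, Or.inl ⟨rfl, ?_⟩⟩
      unfold nxt; rw [if_pos (by omega), h.1]
  have hedinj : ∀ i i', i < n → i' < n → s(p i, p (nxt n k i)) = s(p i', p (nxt n k i')) →
      i = i' := by
    intro i i' hi hi' h
    rw [Sym2.eq_iff] at h
    rcases h with h | h
    · exact hp.inj _ _ hi hi' h.1
    · have h1 := hp.inj _ _ hi (hnx _ hi') h.1
      have h2 := hp.inj _ _ (hnx _ hi) hi' h.2
      unfold nxt at h1 h2
      split_ifs at h1 h2 <;> omega
  -- reconstruct
  have hrec : ∀ (H : G.Subgraph) (a b : ℕ), b < n →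
      H.verts = {x | ∃ i, i < n ∧ p i = x ∧ (i ≤ a ∨ b < i)} →
      (∀ i, i < n → (i < a ∨ b < i) → H.Adj (p i) (p (nxt n k i))) →
      (∀ i, a ≤ i → i ≤ b → ¬ H.Adj (p i) (p (nxt n k i))) → H = lolK G n k p a b := by
    intro H a b hb hv h1 h2
    have hmain : ∀ i, i < n → (H.Adj (p i) (p (nxt n k i)) ↔
        (lolK G n k p a b).Adj (p i) (p (nxt n k i))) := by
      intro i hi
      constructor
      · intro h
        refine ⟨h.adj_sub, ?_, ?_, ?_⟩
        · rw [← hv]; exact h.fst_mem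
        · rw [← hv]; exact h.snd_mem
        · rintro ⟨i', hi1, hi2, he⟩
          have := hedinj _ _ hi (by omega) he
          subst this
          exact h2 i hi1 hi2 h
      · intro h
        apply h1 i hi
        by_contra hcon
        exact h.2.2.2 ⟨i, by omega, by omega, rfl⟩
    apply Subgraph.ext
    · rw [hv]; rfl
    · ext x y
      constructor
      · intro h
        obtain ⟨i, hi, ⟨rfl, rfl⟩ | ⟨rfl, rfl⟩⟩ := hadj x y h.adj_sub
        · exact (hmain i hi).1 h
        · exact ((hmain i hi).1 h.symm).symm
      · intro h
        obtain ⟨i, hi, ⟨rfl, rfl⟩ | ⟨rfl, rfl⟩⟩ := hadj x y h.adj_sub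
        · exact (hmain i hi).2 h
        · exact ((hmain i hi).2 h.symm).symm
  let C : Finset (Σ _ : ℕ, ℕ) := (Finset.Ico k n).sigma (fun a => Finset.Ico a n) ∪
    (Finset.range k).image (fun a => (⟨a, n - 1⟩ : Σ _ : ℕ, ℕ))
  have hC : C.card ≤ (n - k + 1).choose 2 + k := by
    refine (Finset.card_union_le _ _).trans (Nat.add_le_add ?_ ?_)
    · rw [Finset.card_sigma, Finset.sum_Ico_eq_sum_range, ← sum_tri]
      apply le_of_eq
      apply Finset.sum_congr rfl
      intro t _
      rw [Nat.card_Ico]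
      omega
    · exact Finset.card_image_le.trans (by simp)
  let K : Finset G.Subgraph := insert (⊤ : G.Subgraph) (C.image fun c => lolK G n k p c.1 c.2)
  have hK : K.card ≤ 1 + n + (n - k).choose 2 := by
    have h1 := Finset.card_insert_le (⊤ : G.Subgraph) (C.image fun c => lolK G n k p c.1 c.2)
    have h2 := Finset.card_image_le (s := C) (f := fun c => lolK G n k p c.1 c.2)
    have h3 := Nat.choose_succ_succ' (n - k) 1
    simp at h3
    have : K.card ≤ _ := h1
    omega
  refine le_trans ?_ hK
  rw [← Set.ncard_coe_finset]
  refine Set.ncard_le_ncard ?_ (Set.toFinite _)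
  rintro H ⟨hH, hvH⟩
  let M : Finset ℕ := (Finset.range n).filter fun i => ¬ H.Adj (p i) (p (nxt n k i))
  have hMm : ∀ i, i ∈ M ↔ i < n ∧ ¬ H.Adj (p i) (p (nxt n k i)) := by
    intro i; simp [M]
  rw [Finset.mem_coe, Finset.mem_insert]
  by_cases hM : M.Nonempty
  · right
    let a := M.min' hM
    let b := M.max' hM
    have ha : a ∈ M := Finset.min'_mem _ _
    have hb : b ∈ M := Finset.max'_mem _ _
    have hab : a ≤ b := Finset.min'_le _ _ hb
    rw [hMm] at ha hb
    have ha' : ∀ i, i < a → H.Adj (p i) (p (nxt n k i)) := by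
      intro i hi
      by_contra hcon
      have : a ≤ i := Finset.min'_le _ _ ((hMm i).2 ⟨by omega, hcon⟩)
      omega
    have hb' : ∀ i, i < n → b < i → H.Adj (p i) (p (nxt n k i)) := by
      intro i hin hi
      by_contra hcon
      have : i ≤ b := Finset.le_max' _ _ ((hMm i).2 ⟨by omega, hcon⟩)
      omega
    have hva : ∀ i, i ≤ a → p i ∈ H.verts := by
      intro i hi
      cases i with
      | zero => rw [hp.zero]; exact hvH
      | succ i =>
        have h1 := (ha' i (by omega)).snd_mem
        unfold nxt at h1
        rwa [if_neg (by omega)] at h1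
    have hvb : ∀ i, i < n → b < i → p i ∈ H.verts := fun i hin hi => (hb' i hin hi).fst_mem
    -- closure
    have hcl : ∀ S : ℕ → Prop, S 0 →
        (∀ i, i < n → H.Adj (p i) (p (nxt n k i)) → (S i ↔ S (nxt n k i))) →
        ∀ x ∈ H.verts, ∃ i, i < n ∧ p i = x ∧ S i := by
      intro S h0 hS x hx
      refine reach_closed (S := {x | ∃ i, i < n ∧ p i = x ∧ S i}) (conn_reach H hH hvH hx)
        ⟨0, by omega, hp.zero, h0⟩ ?_
      rintro x y ⟨i, hi, rfl, hSi⟩ hxy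
      have hxy' : H.Adj (p i) y := hxy
      obtain ⟨e, he, ⟨h1, rfl⟩ | ⟨rfl, h1⟩⟩ := hadj _ y hxy'.adj_sub
      · have := hp.inj _ _ hi he h1
        subst this
        exact ⟨_, hnx _ hi, rfl, (hS i hi hxy').1 hSi⟩
      · have := hp.inj _ _ hi (hnx _ he) h1
        subst this
        exact ⟨_, he, rfl, (hS e he hxy'.symm).2 hSi⟩
    rw [Finset.mem_image]
    by_cases hak : a < k
    · have hvs : ∀ x ∈ H.verts, ∃ i, i < n ∧ p i = x ∧ i ≤ a := by
        apply hcl _ (by omega)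
        intro i hi hadj'
        have : i ≠ a := by rintro rfl; exact ha.2 hadj'
        unfold nxt
        split_ifs <;> omega
      refine ⟨⟨a, n - 1⟩, ?_, ?_⟩
      · apply Finset.mem_union_right
        rw [Finset.mem_image]
        exact ⟨a, by simpa using hak, rfl⟩
      · symm
        apply hrec H a (n - 1) (by omega)
        · ext x
          constructor
          · intro hx
            obtain ⟨i, h1, h2, h3⟩ := hvs x hx
            exact ⟨i, h1, h2, Or.inl h3⟩
          · rintro ⟨i, h1, rfl, h3⟩
            exact hva i (by omega)
        · intro i hi hi'
          exact ha' i (by omega)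
        · intro i hi hi' hadj'
          obtain ⟨i', h1, h2, h3⟩ := hvs _ hadj'.fst_mem
          have := hp.inj _ _ h1 (by omega) h2
          have : i = a := by omega
          subst this
          exact ha.2 hadj'
    · have hvs : ∀ x ∈ H.verts, ∃ i, i < n ∧ p i = x ∧ (i ≤ a ∨ b < i) := by
        apply hcl (fun i => i ≤ a ∨ b < i) (by omega)
        intro i hi hadj'
        have : i ≠ a := by rintro rfl; exact ha.2 hadj'
        have : i ≠ b := by rintro rfl; exact hb.2 hadj'
        unfold nxt
        split_ifs <;> omega
      refine ⟨⟨a, b⟩, ?_, ?_⟩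
      · apply Finset.mem_union_left
        simp only [Finset.mem_sigma, Finset.mem_Ico]
        omega
      · symm
        apply hrec H a b (by omega)
        · ext x
          constructor
          · intro hx
            exact hvs x hx
          · rintro ⟨i, h1, rfl, h3 | h3⟩
            · exact hva i h3
            · exact hvb i h1 h3
        · rintro i hi (hi' | hi')
          · exact ha' i hi'
          · exact hb' i hi hi'
        · intro i hi hi' hadj'
          have hia : i ≠ a := by rintro rfl; exact ha.2 hadj'
          have hib : i ≠ b := by rintro rfl; exact hb.2 hadj'
          obtain ⟨i', h1, h2, h3⟩ := hvs _ hadj'.fst_mem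
          have := hp.inj _ _ h1 (by omega) h2
          omega
  · left
    rw [Finset.not_nonempty_iff_eq_empty] at hM
    have hall : ∀ i, i < n → H.Adj (p i) (p (nxt n k i)) := by
      intro i hi
      by_contra hcon
      have := (hMm i).2 ⟨hi, hcon⟩
      rw [hM] at this
      simp at this
    apply Subgraph.ext
    · ext x
      obtain ⟨i, hi, rfl⟩ := hp.surj x
      simp [(hall i hi).fst_mem]
    · ext x y
      simp only [Subgraph.top_adj]
      constructor
      · exact fun h => h.adj_sub
      · intro h
        obtain ⟨i, hi, ⟨rfl, rfl⟩ | ⟨rfl, rfl⟩⟩ := hadj x y h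
        · exact hall i hi
        · exact (hall i hi).symm

open Classical in
theorem struct_lol {V : Type*} [Fintype V] (G : SimpleGraph V) (hG : G.Connected) (v : V)
    (hv : G.degree v = 1) (hd : ∀ x, x ≠ v → 2 ≤ G.degree x)
    (hE : G.edgeFinset.card = Fintype.card V) :
    ∃ k p, 1 ≤ k ∧ k + 3 ≤ Fintype.card V ∧ IsLol G v (Fintype.card V) k p := by
  let P : ℕ → Prop := fun L => ∃ p : ℕ → V, p 0 = v ∧
    (∀ i i', i ≤ L → i' ≤ L → p i = p i' → i = i') ∧ ∀ i, i < L → G.Adj (p i) (p (i + 1))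
  have hPb : ∀ L, P L → L + 1 ≤ Fintype.card V := by
    rintro L ⟨p, -, hinj, -⟩
    have : ((Finset.range (L + 1)).image p).card = L + 1 := by
      rw [Finset.card_image_of_injOn]
      · simp
      · intro i hi i' hi' h
        simp at hi hi'
        exact hinj i i' (by omega) (by omega) h
    rw [← this]
    exact Finset.card_le_univ _
  have hP0 : P 0 := ⟨fun _ => v, rfl, fun i i' hi hi' _ => by omega, fun i hi => by omega⟩
  obtain ⟨L, hL, hmax⟩ : ∃ L, P L ∧ ¬ P (L + 1) := by
    by_contra hcon
    push Not at hcon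
    have : ∀ L, P L := fun L => by
      induction L with
      | zero => exact hP0
      | succ L ih => exact hcon L ih
    have := hPb _ (this (Fintype.card V))
    omega
  have hLn := hPb L hL
  obtain ⟨p, hp0, hinj, hstep⟩ := hL
  have hend : ∀ z, G.Adj (p L) z → ∃ i, i < L ∧ z = p i := by
    intro z hz
    by_contra hcon
    push Not at hcon
    apply hmax
    have hne : ∀ i, i ≤ L → p i ≠ z := by
      intro i hi h
      rcases Nat.lt_or_ge i L with h1 | h1
      · exact hcon i h1 h.symm
      · have : i = L := by omega
        subst this
        exact hz.ne h
    refine ⟨fun i => if i ≤ L then p i else z, by simpa using hp0, ?_, ?_⟩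
    · intro i i' hi hi' h
      by_cases h1 : i ≤ L <;> by_cases h2 : i' ≤ L <;> simp only [h1, h2, if_true, if_false] at h
      · exact hinj i i' h1 h2 h
      · exact absurd h (hne i h1)
      · exact absurd h.symm (hne i' h2)
      · omega
    · intro i hi
      by_cases h1 : i < L
      · simp only [show i ≤ L by omega, show i + 1 ≤ L by omega, if_true]
        exact hstep i h1
      · have : i = L := by omega
        subst this
        simpa using hz
  have hL1 : 1 ≤ L := by
    by_contra hcon
    have hL0 : L = 0 := by omega
    have : 0 < G.degree v := by omega
    obtain ⟨w, hw⟩ := (degree_pos_iff_exists_adj _ _).1 this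
    rw [← hp0, ← hL0] at hw
    obtain ⟨i, hi, -⟩ := hend w hw
    omega
  have hpv : ∀ i, i ≤ L → i ≠ 0 → p i ≠ v := by
    intro i hi hi0 h
    rw [← hp0] at h
    exact hi0 (hinj _ _ hi (by omega) h)
  obtain ⟨k, hkL, hadjk⟩ : ∃ k, k + 1 < L ∧ G.Adj (p L) (p k) := by
    have h3 : 1 < (G.neighborFinset (p L)).card := hd _ (hpv L le_rfl (by omega))
    obtain ⟨a, ha, b, hb, hab⟩ := Finset.one_lt_card.1 h3
    rw [mem_neighborFinset] at ha hb
    obtain ⟨i, hi, rfl⟩ := hend a ha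
    obtain ⟨i', hi', rfl⟩ := hend b hb
    have : i ≠ i' := fun h => hab (by rw [h])
    by_cases h : i + 1 < L
    · exact ⟨i, h, ha⟩
    · exact ⟨i', by omega, hb⟩
  have hk1 : 1 ≤ k := by
    by_contra hcon
    have hk0 : k = 0 := by omega
    subst hk0
    have : 1 < (G.neighborFinset v).card := by
      rw [Finset.one_lt_card]
      refine ⟨p 1, ?_, p L, ?_, ?_⟩
      · rw [mem_neighborFinset, ← hp0]; exact hstep 0 (by omega)
      · rw [mem_neighborFinset, ← hp0]; exact hadjk.symm
      · intro h
        have := hinj _ _ (by omega) (by omega) h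
        omega
    have h2 : (G.neighborFinset v).card = 1 := hv
    omega
  -- neighbourhoods
  have hpne : ∀ i i', i ≤ L → i' ≤ L → i ≠ i' → p i ≠ p i' := fun i i' hi hi' h h' =>
    h (hinj _ _ hi hi' h')
  have hsub3 : ({p (k - 1), p (k + 1), p L} : Finset V) ⊆ G.neighborFinset (p k) := by
    intro z hz
    simp only [Finset.mem_insert, Finset.mem_singleton] at hz
    rw [mem_neighborFinset]
    rcases hz with rfl | rfl | rfl
    · have := hstep (k - 1) (by omega)
      rw [show k - 1 + 1 = k by omega] at this
      exact this.symm
    · exact hstep k (by omega)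
    · exact hadjk.symm
  have hcard3 : ({p (k - 1), p (k + 1), p L} : Finset V).card = 3 := by
    rw [Finset.card_eq_three]
    exact ⟨_, _, _, hpne _ _ (by omega) (by omega) (by omega), hpne _ _ (by omega) (by omega) (by omega),
      hpne _ _ (by omega) (by omega) (by omega), rfl⟩
  have hkv : p k ≠ v := hpv k (by omega) (by omega)
  have hdeg3 : 3 ≤ G.degree (p k) := by
    rw [← hcard3]; exact Finset.card_le_card hsub3
  have hle : ∀ x ∈ Finset.univ, (if x = p k then 3 else if x = v then 1 else 2) ≤ G.degree x := by
    intro x _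
    split_ifs with h1 h2
    · rw [h1]; exact hdeg3
    · rw [h2, hv]
    · exact hd x h2
  have hsum : ∑ x, (if x = p k then 3 else if x = v then 1 else 2) = ∑ x, G.degree x := by
    rw [G.sum_degrees_eq_twice_card_edges, hE]
    have : ∀ x, (if x = p k then 3 else if x = v then 1 else 2) + (if x = v then 1 else 0) =
        2 + (if x = p k then 1 else 0) := by
      intro x
      by_cases h1 : x = p k
      · have : x ≠ v := by rw [h1]; exact hkv
        simp [h1, hkv]
      · by_cases h2 : x = v
        · simp [h2, hkv.symm]
        · simp [h1, h2]
    have h2 := Finset.sum_congr (rfl : (Finset.univ : Finset V) = Finset.univ) (fun x _ => this x)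
    rw [Finset.sum_add_distrib, Finset.sum_add_distrib] at h2
    rw [Finset.sum_ite_eq', Finset.sum_ite_eq'] at h2
    simp only [Finset.mem_univ, if_true, Finset.sum_const, Finset.card_univ, smul_eq_mul] at h2
    omega
  have hdeg := (Finset.sum_eq_sum_iff_of_le hle).1 hsum
  have hnb : ∀ i z, i ≤ L → G.Adj (p i) z → (0 < i ∧ z = p (i - 1)) ∨ (i < L ∧ z = p (i + 1)) ∨
      (i = k ∧ z = p L) ∨ (i = L ∧ z = p k) := by
    intro i z hi hz
    rw [← mem_neighborFinset] at hz
    have hdi : (if p i = p k then 3 else if p i = v then 1 else 2) = (G.neighborFinset (p i)).card :=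
      hdeg (p i) (Finset.mem_univ _)
    have hprev : 0 < i → p (i - 1) ∈ G.neighborFinset (p i) := by
      intro h
      rw [mem_neighborFinset]
      have := hstep (i - 1) (by omega)
      rw [show i - 1 + 1 = i by omega] at this
      exact this.symm
    have hnext : i < L → p (i + 1) ∈ G.neighborFinset (p i) := by
      intro h
      rw [mem_neighborFinset]
      exact hstep i h
    by_cases hik : i = k
    · subst hik
      rw [if_pos rfl] at hdi
      have := Finset.eq_of_subset_of_card_le hsub3 (by omega)
      rw [← this] at hz
      simp only [Finset.mem_insert, Finset.mem_singleton] at hz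
      rcases hz with h | h | h
      · left; exact ⟨by omega, h⟩
      · right; left; exact ⟨by omega, h⟩
      · right; right; left; exact ⟨rfl, h⟩
    rw [if_neg (hpne _ _ hi (by omega) hik)] at hdi
    by_cases hi0 : i = 0
    · subst hi0
      rw [if_pos hp0] at hdi
      have : ({p 1} : Finset V) = G.neighborFinset (p 0) := by
        apply Finset.eq_of_subset_of_card_le
        · rw [Finset.singleton_subset_iff]; exact hnext (by omega)
        · rw [← hdi]; simp
      rw [← this, Finset.mem_singleton] at hz
      right; left; exact ⟨by omega, hz⟩
    rw [if_neg (hpv i hi hi0)] at hdi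
    by_cases hiL : i = L
    · subst hiL
      have : ({p (i - 1), p k} : Finset V) = G.neighborFinset (p i) := by
        apply Finset.eq_of_subset_of_card_le
        · intro y hy
          simp only [Finset.mem_insert, Finset.mem_singleton] at hy
          rcases hy with rfl | rfl
          · exact hprev (by omega)
          · rw [mem_neighborFinset]; exact hadjk
        · rw [← hdi, Finset.card_pair (hpne _ _ (by omega) (by omega) (by omega))]
      rw [← this] at hz
      simp only [Finset.mem_insert, Finset.mem_singleton] at hz
      rcases hz with h | h
      · left; exact ⟨by omega, h⟩
      · right; right; right; exact ⟨rfl, h⟩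
    · have : ({p (i - 1), p (i + 1)} : Finset V) = G.neighborFinset (p i) := by
        apply Finset.eq_of_subset_of_card_le
        · intro y hy
          simp only [Finset.mem_insert, Finset.mem_singleton] at hy
          rcases hy with rfl | rfl
          · exact hprev (by omega)
          · exact hnext (by omega)
        · rw [← hdi, Finset.card_pair (hpne _ _ (by omega) (by omega) (by omega))]
      rw [← this] at hz
      simp only [Finset.mem_insert, Finset.mem_singleton] at hz
      rcases hz with h | h
      · left; exact ⟨by omega, h⟩
      · right; left; exact ⟨by omega, h⟩
  have hsurj : ∀ x, ∃ i, i ≤ L ∧ p i = x := by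
    intro x
    refine reach_closed (S := {x | ∃ i, i ≤ L ∧ p i = x}) (hG.preconnected v x)
      ⟨0, by omega, hp0⟩ ?_
    rintro a b ⟨i, hi, rfl⟩ hab
    rcases hnb i b hi hab with h | h | h | h
    · exact ⟨i - 1, by omega, h.2.symm⟩
    · exact ⟨i + 1, by omega, h.2.symm⟩
    · exact ⟨L, by omega, h.2.symm⟩
    · exact ⟨k, by omega, h.2.symm⟩
  have hn : Fintype.card V = L + 1 := by
    apply le_antisymm _ hLn
    have : (Finset.univ : Finset V) ⊆ (Finset.range (L + 1)).image p := by
      intro x _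
      obtain ⟨i, hi, h⟩ := hsurj x
      rw [Finset.mem_image]
      exact ⟨i, by simp; omega, h⟩
    have h2 := (Finset.card_le_card this).trans Finset.card_image_le
    simpa using h2
  refine ⟨k, p, hk1, by omega, hp0, ?_, ?_, ?_⟩
  · intro i i' hi hi' h
    exact hinj i i' (by omega) (by omega) h
  · intro x
    obtain ⟨i, hi, h⟩ := hsurj x
    exact ⟨i, by omega, h⟩
  · intro i i' hi hi'
    unfold lolA
    constructor
    · intro h
      rcases hnb i _ (by omega) h with ⟨h1, h⟩ | ⟨h1, h⟩ | ⟨h1, h⟩ | ⟨h1, h⟩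
      · have := hinj _ _ (by omega) (by omega) h
        right; left; omega
      · have := hinj _ _ (by omega) (by omega) h
        left; left; omega
      · have := hinj _ _ (by omega) (by omega) h
        left; right; omega
      · have := hinj _ _ (by omega) (by omega) h
        right; right; omega
    · rintro ((h | ⟨h, h'⟩) | (h | ⟨h, h'⟩))
      · rw [h]; exact hstep i (by omega)
      · rw [h, h', show Fintype.card V - 1 = L by omega]; exact hadjk.symm
      · rw [h]; exact (hstep i' (by omega)).symm
      · rw [h, h', show Fintype.card V - 1 = L by omega]; exact hadjk

open Classical in
theorem nb_two {V : Type*} [Fintype V] {G : SimpleGraph V} (hG : G.Connected) (hnt : ¬ G.IsTree) :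
    3 ≤ (nbG G).edgeFinset.card := by
  have hac : ¬ G.IsAcyclic := fun h => hnt ⟨hG, h⟩
  unfold IsAcyclic at hac
  push Not at hac
  obtain ⟨a, c, hc⟩ := hac
  have h1 : c.edges.toFinset ⊆ (nbG G).edgeFinset := by
    intro e he
    rw [List.mem_toFinset] at he
    rw [mem_edgeFinset]
    have h2 : ¬ G.IsBridge e := fun h => h.notMem_edges_of_isCycle hc he
    have h3 : e ∈ G.edgeSet := c.edges_subset_edgeSet he
    induction e with
    | h a b => exact ⟨h3, h2⟩
  have h2 := Finset.card_le_card h1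
  rw [List.toFinset_card_of_nodup hc.edges_nodup, Walk.length_edges] at h2
  exact hc.three_le_length.trans h2

theorem two_choose (m : ℕ) : 2 * (m + 1).choose 2 = (m + 1) * m := by
  induction m with
  | zero => simp
  | succ m ih =>
    rw [Nat.choose_succ_succ' (m + 1) 1, Nat.choose_one_right, Nat.mul_add, ih]
    ring

theorem main_count {V : Type*} [Fintype V] (G : SimpleGraph V)
    (n k : ℕ) (hn : Fintype.card V = n) (hG : G.Connected) (hnt : ¬ G.IsTree)
    (hk : {v : V | IsCutVertex G v}.ncard = k) (hk1 : 1 ≤ k) (hkn : k + 3 ≤ n) (v : V) :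
    1 + n + (n - k).choose 2 ≤ numCSv G v ∧
      (numCSv G v = 1 + n + (n - k).choose 2 → ∃ j p, 1 ≤ j ∧ j + 3 ≤ n ∧ IsLol G v n j p) := by
  classical
  have hsplit : numCSv G v = {H : G.Subgraph | (H.Connected ∧ v ∈ H.verts) ∧ H.IsInduced}.ncard +
      {H : G.Subgraph | (H.Connected ∧ v ∈ H.verts) ∧ ¬ H.IsInduced}.ncard := by
    unfold numCSv
    rw [← Set.ncard_union_eq _ (Set.toFinite _) (Set.toFinite _)]
    · congr 1
      ext H
      simp only [Set.mem_union, Set.mem_ofPred_eq]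
      tauto
    · rw [Set.disjoint_left]
      intro H h1 h2
      exact h2.2 h1.2
  -- finsets
  let NC : Finset V := Finset.univ.filter fun x => ¬ IsCutVertex G x
  let CV : Finset V := Finset.univ.filter fun x => IsCutVertex G x
  have hCV : CV.card = k := by
    rw [← hk, ← Set.ncard_coe_finset]
    congr 1
    ext x
    simp [CV]
  have hNC : CV.card + NC.card = n := by
    rw [← hn]
    exact Finset.card_filter_add_card_filter_not (s := Finset.univ) (fun x => IsCutVertex G x)
  obtain ⟨u, hu⟩ : ∃ u, IsCutVertex G u := by
    have : 0 < CV.card := by omega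
    obtain ⟨u, hu⟩ := Finset.card_pos.1 this
    exact ⟨u, by simpa [CV] using hu⟩
  have hdpos : ∀ x, 0 < G.degree x := by
    intro x
    have : Nontrivial V := by
      rw [← Fintype.one_lt_card_iff_nontrivial]; omega
    exact hG.preconnected.degree_pos_of_nontrivial x
  let Q : Finset V := NC.filter fun x => 2 ≤ G.degree x
  let L : Finset V := Finset.univ.filter fun x => x ≠ v ∧ G.degree x = 1
  have hQ := nb_card hG hnt u hu Q (by
    intro x hx
    simpa [Q, NC] using hx)
  have hind := count_induced G hG v (NC.erase v) (by
    intro x hx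
    simpa [NC] using hx)
  have hnon := count_nonind G hG hnt v L (by
    intro x hx
    have hx' : x ≠ v ∧ G.degree x = 1 := by simpa [L] using hx
    refine ⟨hx'.1, ?_⟩
    obtain ⟨y, hy⟩ := Finset.card_eq_one.1 (show (G.neighborFinset x).card = 1 from hx'.2)
    refine ⟨y, fun z hz => ?_⟩
    rw [← mem_neighborFinset, hy] at hz
    simpa using hz)
  have hm : NC.card = n - k := by omega
  have hE1 : n ≤ G.edgeFinset.card := by
    by_contra hcon
    apply hnt
    have h1 := hG.card_vert_le_card_edgeSet_add_one
    rw [isTree_iff_connected_and_card]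
    refine ⟨hG, ?_⟩
    rw [Nat.card_eq_fintype_card, Nat.card_eq_fintype_card] at *
    rw [edgeFinset_card] at hcon
    omega
  rw [hn] at hind hnon
  rw [hsplit]
  set I := {H : G.Subgraph | (H.Connected ∧ v ∈ H.verts) ∧ H.IsInduced}.ncard
  set J := {H : G.Subgraph | (H.Connected ∧ v ∈ H.verts) ∧ ¬ H.IsInduced}.ncard
  set E' := (nbG G).edgeFinset.card
  have hE2 : 3 ≤ E' := nb_two hG hnt
  have hmul : (L.card + 1) * E' = E' + L.card * E' := by ring
  have hmul2 : L.card * 3 ≤ L.card * E' := Nat.mul_le_mul_left _ hE2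
  by_cases hvc : v ∈ NC
  · have he : (NC.erase v).card = n - k - 1 := by
      rw [Finset.card_erase_of_mem hvc, hm]
    rw [he] at hind
    have hch : (n - k).choose 2 = (n - k - 1) + (n - k - 1).choose 2 := by
      obtain ⟨t, ht⟩ : ∃ t, n - k = t + 1 := ⟨n - k - 1, by omega⟩
      rw [ht, Nat.choose_succ_succ' t 1]; simp
    have hcover : NC ⊆ Q ∪ L ∪ (if G.degree v = 1 then {v} else ∅) := by
      intro x hx
      simp only [Finset.mem_union, Q, L, Finset.mem_filter, Finset.mem_univ, true_and]
      by_cases h2 : 2 ≤ G.degree x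
      · left; left; exact ⟨hx, h2⟩
      · have := hdpos x
        have h1 : G.degree x = 1 := by omega
        by_cases hxv : x = v
        · right; subst hxv; simp [h1]
        · left; right; exact ⟨hxv, h1⟩
    have hcov := (Finset.card_le_card hcover).trans
      ((Finset.card_union_le _ _).trans (Nat.add_le_add_right (Finset.card_union_le _ _) _))
    have hLE : L.card ≤ L.card * E' := Nat.le_mul_of_pos_right _ (by omega)
    have hone : (if G.degree v = 1 then ({v} : Finset V) else ∅).card ≤ 1 := by
      split_ifs <;> simp
    refine ⟨by split_ifs at hnon <;> omega, ?_⟩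
    intro heq
    have hd1 : G.degree v = 1 := by
      by_contra h
      rw [if_neg h, Finset.card_empty] at hcov
      split_ifs at hnon <;> omega
    rw [if_pos hd1, Finset.card_singleton] at hcov
    have hE3 : G.edgeFinset.card = n := by
      by_contra h
      rw [if_pos (by omega)] at hnon
      omega
    have hL0 : L.card = 0 := by
      by_contra h
      split_ifs at hnon <;> omega
    have hst := struct_lol G hG v hd1 (by
      intro x hx
      by_contra h
      have := hdpos x
      have : x ∈ L := by
        simp only [L, Finset.mem_filter, Finset.mem_univ, true_and]
        exact ⟨hx, by omega⟩
      rw [Finset.card_eq_zero] at hL0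
      rw [hL0] at this
      simp at this) (by rw [hn]; exact hE3)
    rw [hn] at hst
    exact hst
  · have he : (NC.erase v).card = n - k := by
      rw [Finset.erase_eq_of_notMem hvc, hm]
    rw [he] at hind
    refine ⟨by split_ifs at hnon <;> omega, fun heq => ?_⟩
    exfalso
    split_ifs at hnon <;> omega

theorem lollipop_minimizes_numCSv {V : Type*} [Fintype V] (G : SimpleGraph V)
    (n k : ℕ) (hn : Fintype.card V = n) (hG : G.Connected) (hnt : ¬ G.IsTree)
    (hk : {v : V | IsCutVertex G v}.ncard = k) (hk1 : 1 ≤ k) (hkn : k + 3 ≤ n) :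
    ∀ v : V, (n - k) ^ 2 + n + k + 2 ≤ 2 * numCSv G v ∧
      (2 * numCSv G v = (n - k) ^ 2 + n + k + 2 ↔
        ∃ φ : G ≃g lollipop n k, φ v = ⟨n - 1, by omega⟩) := by
  intro v
  obtain ⟨h1, h2⟩ := main_count G n k hn hG hnt hk hk1 hkn v
  have hval : 2 * (1 + n + (n - k).choose 2) = (n - k) ^ 2 + n + k + 2 := by
    obtain ⟨t, ht⟩ : ∃ t, n - k = t + 1 := ⟨n - k - 1, by omega⟩
    have hc := two_choose t
    have hn' : n = t + 1 + k := by omega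
    rw [ht]
    have : (t + 1) ^ 2 = (t + 1) * t + (t + 1) := by ring
    omega
  rw [← hval]
  refine ⟨by omega, ?_, ?_⟩
  · intro h
    have heq : numCSv G v = 1 + n + (n - k).choose 2 := by omega
    obtain ⟨j, p, hj1, hjn, hp⟩ := h2 heq
    have hkj : k ≤ j := by
      rw [← hk]; exact isLol_cut G hG v n j hj1 hjn p hp
    have hup := isLol_upper G v n j hj1 hjn p hp
    have hjk : j ≤ k := by
      by_contra hcon
      have hmono : (n - j + 1).choose 2 ≤ (n - k).choose 2 := Nat.choose_le_choose 2 (by omega)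
      have hlt := Nat.choose_succ_succ' (n - j) 1
      simp at hlt
      omega
    have : j = k := by omega
    subst this
    exact iso_of_isLol G v n j hj1 hjn p hp
  · rintro ⟨φ, hφ⟩
    obtain ⟨p, hp⟩ := isLol_of_iso G v n k hk1 hkn φ hφ
    have := isLol_upper G v n k hk1 hkn p hp
    omega
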